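/- Let X be a Markov chain on E with transition kernel P and n-step transition probabilities P_n(x,·). Assume that for every pair x, y ∈ E there exists n = n_{x,y} ∈ ℕ such that the measures P_n(x,·) and P_n(y,·) are mutually absolutely continuous (equivalent). Then X has at most one invariant probability measure, and if an invariant probability measure μ exists, then for every x ∈ E the total variation distance ‖P_n(x,·) − μ‖ tends to 0 as n → ∞. -/

import Mathlib

open MeasureTheory ProbabilityTheory Filter ENNReal

/-- The total variation distance `‖μ - ν‖` between two (probability) measures,
with values in `[0,2]`: `‖μ - ν‖ = 2 ⨆_{A measurable} |μ A - ν A|`. -/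
noncomputable def tvDist {E : Type*} [MeasurableSpace E] (μ ν : Measure E) : ℝ≥0∞ :=
  2 * ⨆ (A : Set E) (_ : MeasurableSet A), ((μ A - ν A) ⊔ (ν A - μ A))

/-- The `n`-step transition kernel `P_n` of a Markov kernel `P`. -/
noncomputable def nStep {E : Type*} [MeasurableSpace E] (P : ProbabilityTheory.Kernel E E) :
    ℕ → ProbabilityTheory.Kernel E E
  | 0 => ProbabilityTheory.Kernel.id
  | n + 1 => (nStep P n) ∘ₖ P

lemma sq_mem_unitInterval {E : Type*} {f : E → ℝ} (hf : ∀ x, f x ∈ Set.Icc (0 : ℝ) 1) (x : E) :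
    (f x) ^ 2 ∈ Set.Icc (0 : ℝ) 1 :=
  ⟨sq_nonneg _, pow_le_one₀ (hf x).1 (hf x).2⟩

section Variance

variable {E : Type*} [MeasurableSpace E]

lemma integrable_of_mem_unitInterval {ν : Measure E} [IsFiniteMeasure ν] {f : E → ℝ}
    (hm : Measurable f) (hf : ∀ x, f x ∈ Set.Icc (0 : ℝ) 1) : Integrable f ν :=
  Integrable.of_mem_Icc 0 1 hm.aemeasurable (.of_forall hf)

lemma memLp_two_of_mem_unitInterval {ν : Measure E} [IsFiniteMeasure ν] {f : E → ℝ}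
    (hm : Measurable f) (hf : ∀ x, f x ∈ Set.Icc (0 : ℝ) 1) : MemLp f 2 ν :=
  memLp_of_bounded (.of_forall hf) hm.aestronglyMeasurable 2

lemma measurable_integral_kernel (κ : Kernel E E) {f : E → ℝ} (hm : Measurable f) :
    Measurable fun x ↦ ∫ y, f y ∂κ x :=
  (hm.stronglyMeasurable.integral_kernel).measurable

lemma integral_mem_unitInterval (ν : Measure E) [IsProbabilityMeasure ν] {f : E → ℝ}
    (hm : Measurable f) (hf : ∀ x, f x ∈ Set.Icc (0 : ℝ) 1) :
    ∫ y, f y ∂ν ∈ Set.Icc (0 : ℝ) 1 := by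
  refine ⟨integral_nonneg fun x ↦ (hf x).1, ?_⟩
  calc ∫ y, f y ∂ν ≤ ∫ _, (1 : ℝ) ∂ν :=
        integral_mono (integrable_of_mem_unitInterval hm hf) (integrable_const _) fun x ↦ (hf x).2
    _ = 1 := by simp

lemma integral_integral_of_invariant {κ : Kernel E E} {μ : Measure E}
    (hκ : Kernel.Invariant κ μ) {f : E → ℝ} (hf : Integrable f μ) :
    ∫ x, ∫ y, f y ∂κ x ∂μ = ∫ y, f y ∂μ := by
  have h : (κ ∘ₖ Kernel.const Unit μ) () = μ := by
    rw [← Measure.comp_eq_comp_const_apply, hκ.def]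
  have hi := ProbabilityTheory.Kernel.integral_comp (η := κ) (κ := Kernel.const Unit μ) (a := ())
    (f := f) (by rwa [h])
  rw [h] at hi
  simpa using hi.symm

/-- The law of total variance for a stationary transition. -/
lemma integral_variance_kernel {κ : Kernel E E} [IsMarkovKernel κ] {μ : Measure E}
    [IsProbabilityMeasure μ] (hκ : Kernel.Invariant κ μ) {f : E → ℝ} (hm : Measurable f)
    (hf : ∀ x, f x ∈ Set.Icc (0 : ℝ) 1) :
    ∫ x, Var[f; κ x] ∂μ = Var[f; μ] - Var[fun x ↦ ∫ y, f y ∂κ x; μ] := by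
  have hm' := measurable_integral_kernel κ hm
  have hf' : ∀ x, ∫ y, f y ∂κ x ∈ Set.Icc (0 : ℝ) 1 := fun x ↦ integral_mem_unitInterval _ hm hf
  have hms := hm.pow_const 2
  have hfs := sq_mem_unitInterval hf
  rw [variance_eq_sub (memLp_two_of_mem_unitInterval hm hf),
    variance_eq_sub (memLp_two_of_mem_unitInterval hm' hf'),
    integral_integral_of_invariant hκ (integrable_of_mem_unitInterval hm hf)]
  simp_rw [fun x ↦ variance_eq_sub (memLp_two_of_mem_unitInterval (ν := κ x) hm hf), Pi.pow_apply]
  rw [integral_sub, integral_integral_of_invariant hκ (integrable_of_mem_unitInterval hms hfs)]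
  · ring
  · exact integrable_of_mem_unitInterval (measurable_integral_kernel κ hms)
      fun x ↦ integral_mem_unitInterval _ hms hfs
  · exact integrable_of_mem_unitInterval (hm'.pow_const 2) (sq_mem_unitInterval hf')

lemma integrable_variance_kernel (κ : Kernel E E) [IsMarkovKernel κ] (μ : Measure E)
    [IsProbabilityMeasure μ] {f : E → ℝ} (hm : Measurable f)
    (hf : ∀ x, f x ∈ Set.Icc (0 : ℝ) 1) :
    Measurable (fun x ↦ Var[f; κ x]) ∧ Integrable (fun x ↦ Var[f; κ x]) μ := by
  have hm' := measurable_integral_kernel κ hm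
  have hf' : ∀ x, ∫ y, f y ∂κ x ∈ Set.Icc (0 : ℝ) 1 := fun x ↦ integral_mem_unitInterval _ hm hf
  have hms := hm.pow_const 2
  have hfs := sq_mem_unitInterval hf
  simp_rw [fun x ↦ variance_eq_sub (memLp_two_of_mem_unitInterval (ν := κ x) hm hf), Pi.pow_apply]
  exact ⟨(measurable_integral_kernel κ hms).sub (hm'.pow_const 2),
    (integrable_of_mem_unitInterval (measurable_integral_kernel κ hms)
      fun x ↦ integral_mem_unitInterval _ hms hfs).sub
    (integrable_of_mem_unitInterval (hm'.pow_const 2) (sq_mem_unitInterval hf'))⟩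

lemma variance_integral_kernel_le {κ : Kernel E E} [IsMarkovKernel κ] {μ : Measure E}
    [IsProbabilityMeasure μ] (hκ : Kernel.Invariant κ μ) {f : E → ℝ} (hm : Measurable f)
    (hf : ∀ x, f x ∈ Set.Icc (0 : ℝ) 1) :
    Var[fun x ↦ ∫ y, f y ∂κ x; μ] ≤ Var[f; μ] := by
  have := integral_variance_kernel hκ hm hf
  have : 0 ≤ ∫ x, Var[f; κ x] ∂μ := integral_nonneg fun x ↦ variance_nonneg _ _
  linarith

lemma integral_prod_sq_sub {μ : Measure E} [IsProbabilityMeasure μ] {f : E → ℝ}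
    (hm : Measurable f) (hf : ∀ x, f x ∈ Set.Icc (0 : ℝ) 1) :
    ∫ p : E × E, (f p.1 - f p.2) ^ 2 ∂(μ.prod μ) = 2 * Var[f; μ] := by
  have hms := hm.pow_const 2
  have hfs := sq_mem_unitInterval hf
  have h1 : Integrable (fun p : E × E ↦ f p.1 ^ 2) (μ.prod μ) :=
    integrable_of_mem_unitInterval (hms.comp measurable_fst) fun p ↦ hfs p.1
  have h2 : Integrable (fun p : E × E ↦ f p.2 ^ 2) (μ.prod μ) :=
    integrable_of_mem_unitInterval (hms.comp measurable_snd) fun p ↦ hfs p.2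
  have h3 : Integrable (fun p : E × E ↦ f p.1 * f p.2) (μ.prod μ) :=
    (integrable_of_mem_unitInterval hm hf).mul_prod (integrable_of_mem_unitInterval hm hf)
  have e1 : ∫ p : E × E, f p.1 ^ 2 ∂(μ.prod μ) = ∫ x, f x ^ 2 ∂μ := by
    simpa using integral_fun_fst (μ := μ) (ν := μ) fun x ↦ f x ^ 2
  have e2 : ∫ p : E × E, f p.2 ^ 2 ∂(μ.prod μ) = ∫ x, f x ^ 2 ∂μ := by
    simpa using integral_fun_snd (μ := μ) (ν := μ) fun x ↦ f x ^ 2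
  have e3 : ∫ p : E × E, f p.1 * f p.2 ∂(μ.prod μ) = (∫ x, f x ∂μ) * ∫ x, f x ∂μ :=
    integral_prod_mul f f
  have e : (fun p : E × E ↦ (f p.1 - f p.2) ^ 2)
      = fun p : E × E ↦ f p.1 ^ 2 + f p.2 ^ 2 - 2 * (f p.1 * f p.2) := by
    ext p; ring
  rw [e, integral_sub (by exact h1.add h2) (h3.const_mul 2), integral_add h1 h2, integral_const_mul,
    e1, e2, e3, variance_eq_sub (memLp_two_of_mem_unitInterval hm hf)]
  simp only [Pi.pow_apply]
  ring

lemma sq_sub_integral_mul_le {α β ν : Measure E} [IsProbabilityMeasure α] [IsProbabilityMeasure β]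
    (hα : ν ≤ α) (hβ : ν ≤ β) {f : E → ℝ} (hm : Measurable f)
    (hf : ∀ x, f x ∈ Set.Icc (0 : ℝ) 1) :
    (∫ y, f y ∂α - ∫ y, f y ∂β) ^ 2 * ν.real Set.univ ≤ 2 * (Var[f; α] + Var[f; β]) := by
  have : IsFiniteMeasure ν := isFiniteMeasure_of_le α hα
  have hi (γ : Measure E) [IsFiniteMeasure γ] (c : ℝ) : Integrable (fun y ↦ (f y - c) ^ 2) γ :=
    ((memLp_two_of_mem_unitInterval hm hf).sub (memLp_const c)).integrable_sq
  have hle (γ : Measure E) [IsProbabilityMeasure γ] (h : ν ≤ γ) :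
      ∫ y, (f y - ∫ z, f z ∂γ) ^ 2 ∂ν ≤ Var[f; γ] := by
    rw [variance_eq_integral hm.aemeasurable]
    exact integral_mono_measure h (.of_forall fun y ↦ sq_nonneg _) (hi γ _)
  calc (∫ y, f y ∂α - ∫ y, f y ∂β) ^ 2 * ν.real Set.univ
      = ∫ _, (∫ y, f y ∂α - ∫ y, f y ∂β) ^ 2 ∂ν := by simp [mul_comm]
    _ ≤ ∫ y, (2 * (f y - ∫ z, f z ∂α) ^ 2 + 2 * (f y - ∫ z, f z ∂β) ^ 2) ∂ν := by
        refine integral_mono (integrable_const _) (((hi ν _).const_mul 2).add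
          ((hi ν _).const_mul 2)) fun y ↦ ?_
        nlinarith [sq_nonneg ((f y - ∫ z, f z ∂α) + (f y - ∫ z, f z ∂β))]
    _ = 2 * ∫ y, (f y - ∫ z, f z ∂α) ^ 2 ∂ν + 2 * ∫ y, (f y - ∫ z, f z ∂β) ^ 2 ∂ν := by
        rw [integral_add ((hi ν _).const_mul 2) ((hi ν _).const_mul 2), integral_const_mul,
          integral_const_mul]
    _ ≤ 2 * (Var[f; α] + Var[f; β]) := by linarith [hle α hα, hle β hβ]

/-- The pairs of points whose transition probabilities share a component of mass at least `δ`. -/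
def overlapSet (κ : Kernel E E) (δ : ℝ) : Set (E × E) :=
  {p | ∃ ν : Measure E, ν ≤ κ p.1 ∧ ν ≤ κ p.2 ∧ δ ≤ ν.real Set.univ}

lemma variance_integral_kernel_le_of_overlapSet {κ : Kernel E E} [IsMarkovKernel κ]
    {μ : Measure E} [IsProbabilityMeasure μ] (hκ : Kernel.Invariant κ μ) {δ η : ℝ} (hδ : 0 < δ)
    (hη : 1 - η ≤ (μ.prod μ).real (overlapSet κ δ)) {f : E → ℝ} (hm : Measurable f)
    (hf : ∀ x, f x ∈ Set.Icc (0 : ℝ) 1) :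
    Var[fun x ↦ ∫ y, f y ∂κ x; μ]
      ≤ η + 2 / δ * (Var[f; μ] - Var[fun x ↦ ∫ y, f y ∂κ x; μ]) := by
  have hm' := measurable_integral_kernel κ hm
  have hf' : ∀ x, ∫ y, f y ∂κ x ∈ Set.Icc (0 : ℝ) 1 := fun x ↦ integral_mem_unitInterval _ hm hf
  obtain ⟨hvm, hvi⟩ := integrable_variance_kernel κ μ hm hf
  set h : E → ℝ := fun x ↦ ∫ y, f y ∂κ x
  set v : E → ℝ := fun x ↦ Var[f; κ x]
  have hv0 (x : E) : 0 ≤ v x := variance_nonneg _ _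
  let T : Set (E × E) := {p | (h p.1 - h p.2) ^ 2 * δ ≤ 2 * (v p.1 + v p.2)}
  have hT : MeasurableSet T := by
    refine measurableSet_le ?_ ?_ <;> fun_prop
  have hsub : overlapSet κ δ ⊆ T := by
    rintro p ⟨ν, h1, h2, h3⟩
    exact (mul_le_mul_of_nonneg_left h3 (sq_nonneg _)).trans (sq_sub_integral_mul_le h1 h2 hm hf)
  have hTc : (μ.prod μ).real Tᶜ ≤ η := by
    rw [probReal_compl_eq_one_sub hT]
    linarith [measureReal_mono (μ := μ.prod μ) hsub]
  have i1 : Integrable (fun p : E × E ↦ v p.1) (μ.prod μ) := hvi.comp_fst μ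
  have i2 : Integrable (fun p : E × E ↦ v p.2) (μ.prod μ) := hvi.comp_snd μ
  have e1 : ∫ p : E × E, v p.1 ∂(μ.prod μ) = ∫ x, v x ∂μ := by
    simpa using integral_fun_fst (μ := μ) (ν := μ) v
  have e2 : ∫ p : E × E, v p.2 ∂(μ.prod μ) = ∫ x, v x ∂μ := by
    simpa using integral_fun_snd (μ := μ) (ν := μ) v
  have i12 : Integrable (fun p : E × E ↦ 2 / δ * (v p.1 + v p.2)) (μ.prod μ) :=
    (i1.add i2).const_mul _
  have i3 : Integrable (Tᶜ.indicator (1 : E × E → ℝ)) (μ.prod μ) :=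
    (integrable_const (1 : ℝ)).indicator hT.compl
  have key : 2 * Var[h; μ] ≤ η + 2 / δ * (∫ x, v x ∂μ + ∫ x, v x ∂μ) := by
    rw [← integral_prod_sq_sub hm' hf']
    calc ∫ p : E × E, (h p.1 - h p.2) ^ 2 ∂(μ.prod μ)
        ≤ ∫ p : E × E, (Tᶜ.indicator 1 p + 2 / δ * (v p.1 + v p.2)) ∂(μ.prod μ) := by
          refine integral_mono_of_nonneg (.of_forall fun p ↦ sq_nonneg _)
            (i3.add i12) (.of_forall fun p ↦ ?_)
          have hnn : 0 ≤ 2 / δ * (v p.1 + v p.2) :=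
            mul_nonneg (by positivity) (add_nonneg (hv0 _) (hv0 _))
          by_cases hp : p ∈ T
          · have : (h p.1 - h p.2) ^ 2 ≤ 2 / δ * (v p.1 + v p.2) := by
              rw [div_mul_eq_mul_div, le_div_iff₀ hδ]
              exact hp
            simpa [hp] using this
          · have : (h p.1 - h p.2) ^ 2 ≤ 1 := by
              rw [sq_le_one_iff_abs_le_one, abs_le]
              constructor <;> linarith [(hf' p.1).1, (hf' p.1).2, (hf' p.2).1, (hf' p.2).2]
            simp only [Set.indicator, Set.mem_compl_iff, hp, not_false_eq_true, if_true,
              Pi.one_apply]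
            linarith
      _ = (μ.prod μ).real Tᶜ + 2 / δ * (∫ x, v x ∂μ + ∫ x, v x ∂μ) := by
          rw [integral_add i3 i12, integral_const_mul, integral_add i1 i2,
            e1, e2, integral_indicator_one hT.compl]
      _ ≤ _ := by linarith
  rw [← integral_variance_kernel hκ hm hf]
  have : 0 ≤ Var[h; μ] := variance_nonneg _ _
  have : 0 ≤ 2 / δ * (∫ x, v x ∂μ) := mul_nonneg (by positivity) (integral_nonneg hv0)
  have hη0 : 0 ≤ η := measureReal_nonneg.trans hTc
  linarith

end Variance

section NStep

variable {E : Type*} [MeasurableSpace E] {P : Kernel E E}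

instance isMarkovKernel_nStep [IsMarkovKernel P] : ∀ n, IsMarkovKernel (nStep P n)
  | 0 => by unfold nStep; infer_instance
  | n + 1 => by
    have := isMarkovKernel_nStep n
    unfold nStep; infer_instance

lemma nStep_add (P : Kernel E E) (m n : ℕ) : nStep P (m + n) = nStep P m ∘ₖ nStep P n := by
  induction n with
  | zero => simp [nStep]
  | succ n ih => rw [← add_assoc, nStep, nStep, ih, Kernel.comp_assoc]

lemma invariant_nStep {μ : Measure E} (h : Kernel.Invariant P μ) (n : ℕ) :
    Kernel.Invariant (nStep P n) μ := by
  induction n with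
  | zero => simp [nStep, Kernel.Invariant]
  | succ n ih => exact ih.comp h

lemma integral_nStep_add [IsMarkovKernel P] (m n : ℕ) {f : E → ℝ} (hm : Measurable f)
    (hf : ∀ x, f x ∈ Set.Icc (0 : ℝ) 1) (x : E) :
    ∫ y, f y ∂nStep P (m + n) x = ∫ y, ∫ z, f z ∂nStep P m y ∂nStep P n x := by
  rw [nStep_add]
  exact Kernel.integral_comp (integrable_of_mem_unitInterval hm hf)

lemma bind_nStep_le {n k : ℕ} (hnk : n ≤ k) {x : E} {ν : Measure E} (h : ν ≤ nStep P n x) :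
    ν.bind (nStep P (k - n)) ≤ nStep P k x := by
  obtain ⟨m, rfl⟩ := Nat.exists_eq_add_of_le' hnk
  rw [Nat.add_sub_cancel, nStep_add, Kernel.comp_apply]
  refine Measure.le_iff.2 fun s hs ↦ ?_
  rw [Measure.bind_apply hs (Kernel.aemeasurable _), Measure.bind_apply hs (Kernel.aemeasurable _)]
  exact lintegral_mono' h le_rfl

lemma overlapSet_nStep_mono [IsMarkovKernel P] {n k : ℕ} (hnk : n ≤ k) {δ δ' : ℝ} (hδ : δ' ≤ δ) :
    overlapSet (nStep P n) δ ⊆ overlapSet (nStep P k) δ' := by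
  rintro p ⟨ν, h1, h2, h3⟩
  refine ⟨ν.bind (nStep P (k - n)), bind_nStep_le hnk h1, bind_nStep_le hnk h2, ?_⟩
  have : (ν.bind (nStep P (k - n))) Set.univ = ν Set.univ := by
    rw [Measure.bind_apply .univ (Kernel.aemeasurable _)]
    simp
  rw [Measure.real, this]
  exact hδ.trans h3

lemma exists_le_of_absolutelyContinuous {α β : Measure E} [IsProbabilityMeasure α]
    [IsProbabilityMeasure β] (h : α ≪ β) :
    ∃ ν : Measure E, ν ≤ α ∧ ν ≤ β ∧ 0 < ν.real Set.univ := by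
  have hd : ¬ Disjoint α β := fun hd ↦ by
    have hs := Measure.eq_zero_of_absolutelyContinuous_of_mutuallySingular h
      (Measure.mutuallySingular_of_disjoint hd)
    exact IsProbabilityMeasure.ne_zero α hs
  simp only [Disjoint, not_forall] at hd
  obtain ⟨ν, h1, h2, h3⟩ := hd
  have : IsFiniteMeasure ν := isFiniteMeasure_of_le α h1
  have : NeZero ν := ⟨fun h0 ↦ h3 h0.le⟩
  exact ⟨ν, h1, h2, measureReal_univ_pos⟩

lemma iUnion_overlapSet_nStep [IsMarkovKernel P]
    (hreg : ∀ x y : E, ∃ n : ℕ, nStep P n x ≪ nStep P n y) :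
    ⋃ k : ℕ, overlapSet (nStep P k) (1 / ((k : ℝ) + 1)) = Set.univ := by
  refine Set.eq_univ_of_forall fun p ↦ ?_
  obtain ⟨n, hn⟩ := hreg p.1 p.2
  obtain ⟨ν, h1, h2, h3⟩ := exists_le_of_absolutelyContinuous hn
  obtain ⟨k, hk⟩ := exists_nat_one_div_lt h3
  refine Set.mem_iUnion.2 ⟨max n k, overlapSet_nStep_mono (le_max_left n k) ?_ ⟨ν, h1, h2, le_rfl⟩⟩
  refine (one_div_le_one_div_of_le (by positivity) ?_).trans hk.le
  gcongr
  exact le_max_right n k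

lemma exists_overlapSet_nStep [IsMarkovKernel P] (μ : Measure E) [IsProbabilityMeasure μ]
    (hreg : ∀ x y : E, ∃ n : ℕ, nStep P n x ≪ nStep P n y) {η : ℝ} (hη : 0 < η) :
    ∃ (k : ℕ) (δ : ℝ), 0 < δ ∧ 1 - η ≤ (μ.prod μ).real (overlapSet (nStep P k) δ) := by
  have hmono : Monotone fun k : ℕ ↦ overlapSet (nStep P k) (1 / ((k : ℝ) + 1)) :=
    fun n k hnk ↦ overlapSet_nStep_mono hnk
      (one_div_le_one_div_of_le (by positivity) (by gcongr))
  have ht := tendsto_measure_iUnion_atTop (μ := μ.prod μ) hmono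
  rw [iUnion_overlapSet_nStep hreg, measure_univ] at ht
  have ht' := (ENNReal.tendsto_toReal one_ne_top).comp ht
  rw [toReal_one] at ht'
  obtain ⟨k, hk⟩ := (ht'.eventually_const_lt (show 1 - η < 1 by linarith)).exists
  exact ⟨k, _, by positivity, hk.le⟩

/-- The variance under `μ` of `P_n f` tends to `0`, uniformly over `f` with values in `[0,1]`. -/
lemma exists_variance_nStep_le [IsMarkovKernel P] {μ : Measure E} [IsProbabilityMeasure μ]
    (hμ : Kernel.Invariant P μ) (hreg : ∀ x y : E, ∃ n : ℕ, nStep P n x ≪ nStep P n y)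
    {ε : ℝ} (hε : 0 < ε) :
    ∃ N, ∀ n ≥ N, ∀ f : E → ℝ, Measurable f → (∀ x, f x ∈ Set.Icc (0 : ℝ) 1) →
      Var[fun x ↦ ∫ y, f y ∂nStep P n x; μ] ≤ ε := by
  obtain ⟨k, δ, hδ, hk⟩ := exists_overlapSet_nStep μ hreg (half_pos hε)
  set C : ℝ := 2 / δ
  have hC0 : 0 < C := by positivity
  set θ : ℝ := C / (1 + C) with hθ
  have hθ0 : 0 ≤ θ := by positivity
  have hθ1 : θ < 1 := by rw [hθ, div_lt_one (by positivity)]; linarith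
  have step (f : E → ℝ) (hm : Measurable f) (hf : ∀ x, f x ∈ Set.Icc (0 : ℝ) 1) (n : ℕ) :
      Var[fun x ↦ ∫ y, f y ∂nStep P (n + k) x; μ] - ε / 2
        ≤ θ * (Var[fun x ↦ ∫ y, f y ∂nStep P n x; μ] - ε / 2) := by
    have h := variance_integral_kernel_le_of_overlapSet (invariant_nStep hμ k) hδ hk
      (measurable_integral_kernel (nStep P n) hm) fun x ↦ integral_mem_unitInterval _ hm hf
    simp_rw [integral_nStep_add (P := P) n k hm hf]
    rw [hθ, div_mul_eq_mul_div, le_div_iff₀ (by positivity)]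
    linarith
  have geom (j : ℕ) : ∀ f : E → ℝ, Measurable f → (∀ x, f x ∈ Set.Icc (0 : ℝ) 1) →
      Var[fun x ↦ ∫ y, f y ∂nStep P (j * k) x; μ] - ε / 2 ≤ θ ^ j := by
    intro f hm hf
    induction j with
    | zero =>
      have := variance_le_sq_of_bounded (μ := μ) (.of_forall fun x ↦
        integral_mem_unitInterval (nStep P (0 * k) x) hm hf)
        (measurable_integral_kernel _ hm).aemeasurable
      rw [pow_zero]
      linarith
    | succ j ih =>
      rw [add_mul, one_mul, pow_succ']
      exact (step f hm hf _).trans (mul_le_mul_of_nonneg_left ih hθ0)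
  obtain ⟨j, hj⟩ := exists_pow_lt_of_lt_one (half_pos hε) hθ1
  refine ⟨j * k, fun n hn f hm hf ↦ ?_⟩
  obtain ⟨m, rfl⟩ := Nat.exists_eq_add_of_le hn
  simp_rw [integral_nStep_add (P := P) (j * k) m hm hf]
  refine (variance_integral_kernel_le (invariant_nStep hμ m)
    (measurable_integral_kernel _ hm) fun x ↦ integral_mem_unitInterval _ hm hf).trans ?_
  linarith [geom j f hm hf]

lemma exists_nStep_absolutelyContinuous [IsMarkovKernel P] {μ : Measure E} [IsProbabilityMeasure μ]
    (hμ : Kernel.Invariant P μ) (hreg : ∀ x y : E, ∃ n : ℕ, nStep P n x ≪ nStep P n y) (x : E) :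
    ∃ n, nStep P n x ≪ μ := by
  have hs (n : ℕ) : ∃ s, MeasurableSet s ∧ (nStep P n x).singularPart μ sᶜ = 0 ∧ μ s = 0 := by
    obtain ⟨s, hs, h1, h2⟩ := (Measure.mutuallySingular_singularPart (nStep P n x) μ).symm
    exact ⟨s, hs, h2, h1⟩
  choose s hs h1 h2 using hs
  have hA : MeasurableSet (⋃ n, s n) := .iUnion hs
  have hA0 : μ (⋃ n, s n) = 0 := measure_iUnion_null h2
  have hae : ∀ᵐ y ∂μ, ∀ n, nStep P n y (⋃ n, s n) = 0 := by
    refine ae_all_iff.2 fun n ↦ ?_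
    have h := Measure.bind_apply hA (Kernel.aemeasurable (nStep P n) (μ := μ))
    rw [(invariant_nStep hμ n).def, hA0, eq_comm,
      lintegral_eq_zero_iff (Kernel.measurable_coe _ hA)] at h
    exact h
  obtain ⟨y, hy⟩ := hae.exists
  obtain ⟨n, hn⟩ := hreg x y
  refine ⟨n, (Measure.singularPart_eq_zero _ _).1 ?_⟩
  rw [← Measure.measure_univ_eq_zero, ← Set.union_compl_self (s n)]
  refine measure_union_null (le_antisymm ?_ bot_le) (h1 n)
  calc (nStep P n x).singularPart μ (s n) ≤ nStep P n x (s n) := Measure.singularPart_le _ _ _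
    _ ≤ nStep P n x (⋃ n, s n) := measure_mono (Set.subset_iUnion s n)
    _ = 0 := hn (hy n)

lemma abs_integral_sub_le_of_measure_le {α : Measure E} [IsProbabilityMeasure α] {f : E → ℝ}
    (hm : Measurable f) (hf : ∀ x, f x ∈ Set.Icc (0 : ℝ) 1) {c ε : ℝ} (hc : c ∈ Set.Icc (0 : ℝ) 1)
    (hε : 0 ≤ ε) (h : α.real {x | ε ≤ |f x - c|} ≤ ε) :
    |∫ x, f x ∂α - c| ≤ 2 * ε := by
  have hS : MeasurableSet {x | ε ≤ |f x - c|} :=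
    measurableSet_le measurable_const (hm.sub_const c).abs
  have hi : Integrable ({x | ε ≤ |f x - c|}.indicator (1 : E → ℝ)) α :=
    (integrable_const (1 : ℝ)).indicator hS
  calc |∫ x, f x ∂α - c| = |∫ x, (f x - c) ∂α| := by
        rw [integral_sub (integrable_of_mem_unitInterval hm hf) (integrable_const _)]
        simp
    _ ≤ ∫ x, |f x - c| ∂α := abs_integral_le_integral_abs
    _ ≤ ∫ x, ({x | ε ≤ |f x - c|}.indicator 1 x + ε) ∂α := by
        refine integral_mono_of_nonneg (.of_forall fun x ↦ abs_nonneg _)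
          (hi.add (integrable_const _)) (.of_forall fun x ↦ ?_)
        by_cases hx : ε ≤ |f x - c|
        · have : |f x - c| ≤ 1 := by
            rw [abs_le]
            constructor <;> linarith [(hf x).1, (hf x).2, hc.1, hc.2]
          simp only [Set.indicator, Set.mem_ofPred_eq, hx, if_true, Pi.one_apply]
          linarith
        · simp only [Set.indicator, Set.mem_ofPred_eq, hx, if_false]
          linarith
    _ = α.real {x | ε ≤ |f x - c|} + ε := by
        rw [integral_add hi (integrable_const _), integral_indicator_one hS]
        simp
    _ ≤ 2 * ε := by linarith

lemma exists_abs_nStep_sub_le [IsMarkovKernel P] {μ : Measure E} [IsProbabilityMeasure μ]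
    (hμ : Kernel.Invariant P μ) (hreg : ∀ x y : E, ∃ n : ℕ, nStep P n x ≪ nStep P n y) (x : E)
    {ε : ℝ} (hε : 0 < ε) :
    ∃ N, ∀ n ≥ N, ∀ A, MeasurableSet A → |(nStep P n x).real A - μ.real A| ≤ 2 * ε := by
  obtain ⟨m, hm⟩ := exists_nStep_absolutelyContinuous hμ hreg x
  obtain ⟨δ, hδ, hδs⟩ := exists_pos_setLIntegral_lt_of_measure_lt
    (Measure.lintegral_rnDeriv_lt_top (nStep P m x) μ).ne (ofReal_pos.2 hε).ne'
  obtain ⟨δ', hδ'0, hδ'⟩ := ENNReal.lt_iff_exists_real_btwn.1 hδ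
  have hδ'pos : 0 < δ' := ofReal_pos.1 hδ'.1
  obtain ⟨N, hN⟩ := exists_variance_nStep_le hμ hreg (mul_pos hδ'pos (pow_pos hε 2))
  refine ⟨N + m, fun n hn A hA ↦ ?_⟩
  obtain ⟨k, rfl⟩ := Nat.exists_eq_add_of_le' ((Nat.le_add_left m N).trans hn)
  have hk : N ≤ k := by omega
  let f : E → ℝ := A.indicator 1
  have hfm : Measurable f := measurable_one.indicator hA
  have hf : ∀ y, f y ∈ Set.Icc (0 : ℝ) 1 := fun y ↦ by
    by_cases hy : y ∈ A <;> simp [f, hy]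
  have hgm := measurable_integral_kernel (nStep P k) hfm
  have hg : ∀ y, ∫ z, f z ∂nStep P k y ∈ Set.Icc (0 : ℝ) 1 :=
    fun y ↦ integral_mem_unitInterval _ hfm hf
  rw [← integral_indicator_one hA, ← integral_indicator_one hA]
  change |∫ y, f y ∂nStep P (k + m) x - ∫ y, f y ∂μ| ≤ 2 * ε
  rw [integral_nStep_add k m hfm hf]
  refine abs_integral_sub_le_of_measure_le hgm hg (integral_mem_unitInterval μ hfm hf) hε.le ?_
  have hcheb := meas_ge_le_variance_div_sq (μ := μ) (memLp_two_of_mem_unitInterval hgm hg) hε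
  rw [integral_integral_of_invariant (invariant_nStep hμ k)
    (integrable_of_mem_unitInterval hfm hf)] at hcheb
  have hlt := hδs _ (hcheb.trans_lt ((ofReal_le_ofReal
    ((div_le_iff₀ (pow_pos hε 2)).2 (hN k hk f hfm hf))).trans_lt hδ'.2))
  rw [Measure.setLIntegral_rnDeriv hm] at hlt
  exact toReal_le_of_le_ofReal hε.le hlt.le

lemma tvDist_le_of_abs_sub_le {α β : Measure E} [IsProbabilityMeasure α] [IsProbabilityMeasure β]
    {ε : ℝ} (h : ∀ A, MeasurableSet A → |α.real A - β.real A| ≤ ε) :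
    tvDist α β ≤ 2 * ENNReal.ofReal ε := by
  have key (α β : Measure E) [IsProbabilityMeasure α] [IsProbabilityMeasure β] (A : Set E)
      (hA : α.real A - β.real A ≤ ε) : α A - β A ≤ ENNReal.ofReal ε := by
    rw [← ofReal_measureReal (μ := α), ← ofReal_measureReal (μ := β),
      ← ofReal_sub _ measureReal_nonneg]
    exact ofReal_le_ofReal hA
  refine mul_le_mul_right (iSup₂_le fun A hA ↦ sup_le (key α β A ?_) (key β α A ?_)) 2
  · exact (abs_le.1 (h A hA)).2
  · linarith [(abs_le.1 (h A hA)).1]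

end NStep

/-- **Doob's theorem (Theorem 1).** If for every pair `x, y` there is `n` with
`P_n(x,·) ∼ P_n(y,·)`, then the chain has at most one invariant probability measure,
and if an invariant probability measure `μ` exists then `‖P_n(x,·) - μ‖ → 0` for every `x`. -/
theorem doob_equivalent_kernels
    {E : Type*} [MeasurableSpace E] [MeasurableSpace.CountablyGenerated E]
    (hΔ : MeasurableSet {p : E × E | p.1 = p.2})
    (P : ProbabilityTheory.Kernel E E) [IsMarkovKernel P]
    (hreg : ∀ x y : E, ∃ n : ℕ,
      nStep P n x ≪ nStep P n y ∧ nStep P n y ≪ nStep P n x) :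
    (∀ μ₁ μ₂ : Measure E, IsProbabilityMeasure μ₁ → IsProbabilityMeasure μ₂ →
      (∀ A : Set E, MeasurableSet A → μ₁ A = ∫⁻ x, P x A ∂μ₁) →
      (∀ A : Set E, MeasurableSet A → μ₂ A = ∫⁻ x, P x A ∂μ₂) → μ₁ = μ₂) ∧
    (∀ μ : Measure E, IsProbabilityMeasure μ →
      (∀ A : Set E, MeasurableSet A → μ A = ∫⁻ x, P x A ∂μ) →
      ∀ x : E, Tendsto (fun n => tvDist (nStep P n x) μ) atTop (nhds 0)) := by
  have hreg' : ∀ x y : E, ∃ n : ℕ, nStep P n x ≪ nStep P n y :=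
    fun x y ↦ (hreg x y).imp fun _ h ↦ h.1
  have hinv (μ : Measure E) (h : ∀ A : Set E, MeasurableSet A → μ A = ∫⁻ x, P x A ∂μ) :
      Kernel.Invariant P μ := by
    ext A hA
    rw [Measure.bind_apply hA (Kernel.aemeasurable _), ← h A hA]
  refine ⟨fun μ₁ μ₂ _ _ h₁ h₂ ↦ ?_, fun μ _ h x ↦ ?_⟩
  · obtain ⟨x⟩ := μ₁.nonempty_of_neZero
    ext A hA
    rw [← measureReal_eq_measureReal_iff]
    refine eq_of_forall_dist_le fun ε hε ↦ ?_
    have hε' : 0 < ε / 4 := by positivity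
    obtain ⟨N₁, hN₁⟩ := exists_abs_nStep_sub_le (hinv μ₁ h₁) hreg' x hε'
    obtain ⟨N₂, hN₂⟩ := exists_abs_nStep_sub_le (hinv μ₂ h₂) hreg' x hε'
    have a := hN₁ (max N₁ N₂) (le_max_left _ _) A hA
    have b := hN₂ (max N₁ N₂) (le_max_right _ _) A hA
    rw [Real.dist_eq]
    rw [abs_le] at *
    constructor <;> linarith [a.1, a.2, b.1, b.2]
  · refine ENNReal.tendsto_atTop_zero.2 fun ε hε ↦ ?_
    obtain ⟨δ, hδ0, hδ⟩ := ENNReal.lt_iff_exists_real_btwn.1 hε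
    have hδpos : 0 < δ := ofReal_pos.1 hδ.1
    obtain ⟨N, hN⟩ := exists_abs_nStep_sub_le (hinv μ h) hreg' x (ε := δ / 4) (by positivity)
    refine ⟨N, fun n hn ↦ (tvDist_le_of_abs_sub_le (hN n hn)).trans (le_trans (le_of_eq ?_) hδ.2.le)⟩
    rw [← ofReal_ofNat 2, ← ofReal_mul (by positivity)]
    congr 1
    ring
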